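/- Let G be a saturated minimally unsatisfiable CNF formula. Then every pseudo-factor of G is a factor of G. Consequently, a saturated minimally unsatisfiable formula is strongly irreducible if and only if it is irreducible. -/

import Mathlib

/-- A literal: a variable (natural number) with a polarity. -/
abbrev Lit : Type := ℕ × Bool

/-- Negation of a literal. -/
def Lit.neg (ℓ : Lit) : Lit := (ℓ.1, !ℓ.2)

/-- A clause: a finite set of literals. -/
abbrev Clause : Type := Finset Lit

/-- A clause is non-tautological: it contains no literal together with its negation. -/
def Clause.NonTaut (C : Clause) : Prop := ∀ ℓ ∈ C, Lit.neg ℓ ∉ C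

/-- A CNF formula: a finite set of clauses. -/
abbrev CNF : Type := Finset Clause

/-- A CNF formula is well-formed if all of its clauses are non-tautological. -/
def CNF.WellFormed (F : CNF) : Prop := ∀ C ∈ F, C.NonTaut

/-- A (total) assignment `τ` satisfies a literal. -/
def SatLit (τ : ℕ → Bool) (ℓ : Lit) : Prop := τ ℓ.1 = ℓ.2

/-- An assignment satisfies a clause if it satisfies some literal of it. -/
def SatClause (τ : ℕ → Bool) (C : Clause) : Prop := ∃ ℓ ∈ C, SatLit τ ℓ

/-- An assignment satisfies a CNF formula if it satisfies all of its clauses. -/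
def SatCNF (τ : ℕ → Bool) (F : CNF) : Prop := ∀ C ∈ F, SatClause τ C

/-- A CNF formula is unsatisfiable if no assignment satisfies it. -/
def Unsat (F : CNF) : Prop := ¬ ∃ τ : ℕ → Bool, SatCNF τ F

/-- `F` entails `G`: every model of `F` is a model of `G`. -/
def Entails (F G : CNF) : Prop := ∀ τ : ℕ → Bool, SatCNF τ F → SatCNF τ G

/-- Logical equivalence of CNF formulas. -/
def Equivalent (F G : CNF) : Prop := Entails F G ∧ Entails G F

/-- Two clauses clash: one contains a literal whose negation is in the other. -/
def Clash (C D : Clause) : Prop := ∃ ℓ ∈ C, Lit.neg ℓ ∈ D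

/-- A formula is hitting if every pair of distinct clauses clashes. -/
def Hitting (F : CNF) : Prop := ∀ C ∈ F, ∀ D ∈ F, C ≠ D → Clash C D

/-- The set of variables occurring in a CNF formula. -/
def cnfVars (F : CNF) : Finset ℕ := F.sup fun C => C.image Prod.fst

/-- `D` is the resolvent of `C₁` and `C₂` (on the unique clashing literal `ℓ`). -/
def Resolvent (C₁ C₂ D : Clause) : Prop :=
  ∃ ℓ : Lit, C₁ ∩ C₂.image Lit.neg = {ℓ} ∧ D = (C₁ ∪ C₂) \ {ℓ, Lit.neg ℓ}

/-- `L` is a resolution refutation of `F`: every clause of the sequence is an axiom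
(clause of `F`) or a resolvent of two earlier clauses, and the last clause is empty. -/
def IsRefutation (F : CNF) (L : List Clause) : Prop :=
  L ≠ [] ∧ L.getLast? = some (∅ : Clause) ∧
    ∀ i < L.length, L.getD i ∅ ∈ F ∨
      ∃ j k, j < i ∧ k < i ∧ Resolvent (L.getD j ∅) (L.getD k ∅) (L.getD i ∅)

/-- Resolution hardness: the minimum length of a resolution refutation. -/
noncomputable def hardness (F : CNF) : ℕ :=
  sInf {n | ∃ L : List Clause, IsRefutation F L ∧ L.length = n}

/-- The restriction `F[¬C]`: the result of setting all literals of `C` to 0 in `F`. -/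
def restrictByNegC (F : CNF) (C : Clause) : CNF :=
  (F.filter fun D => ∀ ℓ ∈ C, Lit.neg ℓ ∉ D).image fun D => D \ C

/-- `C` is a clause interpolant of `(F, H)`: `F ⊨ C` and `{C} ∪ H` is unsatisfiable. -/
def ClauseInterpolant (C : Clause) (F H : CNF) : Prop :=
  C.NonTaut ∧ Entails F {C} ∧ Unsat (insert C H)

/-- `F` is a factor of `G`: a subset of `G` logically equivalent to a single clause. -/
def IsFactor (F G : CNF) : Prop :=
  F ⊆ G ∧ ∃ C : Clause, C.NonTaut ∧ Equivalent F {C}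

/-- `F` is a pseudo-factor of `G`: `(F, G \ F)` has a clause interpolant. -/
def IsPseudoFactor (F G : CNF) : Prop :=
  F ⊆ G ∧ ∃ C : Clause, ClauseInterpolant C F (G \ F)

/-- `G` is irreducible: every factor has size 1 or `|G|`. -/
def CNF.Irreducible (G : CNF) : Prop :=
  ∀ F : CNF, IsFactor F G → F.card = 1 ∨ F.card = G.card

/-- `G` is strongly irreducible: every pseudo-factor has size 1 or `|G|`. -/
def StronglyIrreducible (G : CNF) : Prop :=
  ∀ F : CNF, IsPseudoFactor F G → F.card = 1 ∨ F.card = G.card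

/-- `F` is minimally unsatisfiable: unsatisfiable, but every proper subset is satisfiable. -/
def MinimallyUnsat (F : CNF) : Prop :=
  Unsat F ∧ ∀ G : CNF, G ⊂ F → ∃ τ : ℕ → Bool, SatCNF τ G

/-- `G` is saturated minimally unsatisfiable: `G` is unsatisfiable and replacing any
clause `C ∈ G` by `C ∪ {ℓ}`, for any literal `ℓ` with `ℓ ∉ C` and `¬ℓ ∉ C`, yields a
satisfiable formula. -/
def SaturatedMU (G : CNF) : Prop :=
  Unsat G ∧ ∀ C ∈ G, ∀ ℓ : Lit, ℓ ∉ C → Lit.neg ℓ ∉ C →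
    ∃ τ : ℕ → Bool, SatCNF τ (insert (insert ℓ C) (G.erase C))

theorem SatClause.mono {τ : ℕ → Bool} {C D : Clause} (h : C ⊆ D) (hC : SatClause τ C) :
    SatClause τ D := by
  obtain ⟨ℓ, hℓ, hs⟩ := hC
  exact ⟨ℓ, h hℓ, hs⟩

theorem satCNF_singleton {τ : ℕ → Bool} {C : Clause} : SatCNF τ {C} ↔ SatClause τ C := by
  simp [SatCNF]

theorem satCNF_of_satCNF_erase {τ : ℕ → Bool} {G : CNF} {D : Clause}
    (h : SatCNF τ (G.erase D)) (hD : SatClause τ D) : SatCNF τ G := by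
  intro E hE
  by_cases hED : E = D
  · exact hED ▸ hD
  · exact h E (Finset.mem_erase.2 ⟨hED, hE⟩)

/-- Deleting a clause from a saturated minimally unsatisfiable formula makes it satisfiable. -/
theorem SaturatedMU.exists_satCNF_erase {G : CNF} (hG : SaturatedMU G) {D : Clause}
    (hD : D ∈ G) : ∃ τ : ℕ → Bool, SatCNF τ (G.erase D) := by
  obtain ⟨v, hv⟩ := Infinite.exists_notMem_finset (D.image Prod.fst)
  have hfresh : ∀ b : Bool, (v, b) ∉ D := fun b hb => hv (Finset.mem_image_of_mem Prod.fst hb)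
  obtain ⟨τ, hτ⟩ := hG.2 D hD (v, true) (hfresh _) (hfresh _)
  exact ⟨τ, fun E hE => hτ E (Finset.mem_insert_of_mem hE)⟩

/-- A clause interpolant of `(F, G \ F)` is contained in every clause of `F`. -/
theorem SaturatedMU.clauseInterpolant_subset {G F : CNF} (hG : SaturatedMU G) (hF : F ⊆ G)
    {C : Clause} (hC : ClauseInterpolant C F (G \ F)) {D : Clause} (hD : D ∈ F) : C ⊆ D := by
  have hfalse : ∀ τ : ℕ → Bool, SatCNF τ (G.erase D) → ¬ SatClause τ C := by
    intro τ hτ hsat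
    refine hC.2.2 ⟨τ, fun E hE => ?_⟩
    rcases Finset.mem_insert.1 hE with rfl | hE
    · exact hsat
    · obtain ⟨hEG, hEF⟩ := Finset.mem_sdiff.1 hE
      exact hτ E (Finset.mem_erase.2 ⟨fun h => hEF (h ▸ hD), hEG⟩)
  intro ℓ hℓ
  by_contra hℓD
  by_cases hneg : Lit.neg ℓ ∈ D
  · obtain ⟨τ, hτ⟩ := hG.exists_satCNF_erase (hF hD)
    have hnot : ¬ SatLit τ ℓ := fun h => hfalse τ hτ ⟨ℓ, hℓ, h⟩
    refine hG.1 ⟨τ, satCNF_of_satCNF_erase hτ ⟨Lit.neg ℓ, hneg, ?_⟩⟩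
    exact Bool.eq_not_iff.2 hnot
  · obtain ⟨τ, hτ⟩ := hG.2 D (hF hD) ℓ hℓD hneg
    have hτ' : SatCNF τ (G.erase D) := fun E hE => hτ E (Finset.mem_insert_of_mem hE)
    obtain ⟨k, hk, hs⟩ := hτ _ (Finset.mem_insert_self _ _)
    rcases Finset.mem_insert.1 hk with rfl | hk
    · exact hfalse τ hτ' ⟨k, hℓ, hs⟩
    · exact hG.1 ⟨τ, satCNF_of_satCNF_erase hτ' ⟨k, hk, hs⟩⟩

theorem SaturatedMU.isFactor_of_isPseudoFactor {G F : CNF} (hG : SaturatedMU G)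
    (h : IsPseudoFactor F G) : IsFactor F G := by
  obtain ⟨hF, C, hC⟩ := h
  exact ⟨hF, C, hC.1, hC.2.1, fun τ hτ D hD =>
    (satCNF_singleton.1 hτ).mono (hG.clauseInterpolant_subset hF hC hD)⟩

/-- Every factor of an unsatisfiable formula is a pseudo-factor. -/
theorem IsFactor.isPseudoFactor {G F : CNF} (hG : Unsat G) (h : IsFactor F G) :
    IsPseudoFactor F G := by
  obtain ⟨hF, C, hC, hFC, hCF⟩ := h
  refine ⟨hF, C, hC, hFC, ?_⟩
  rintro ⟨τ, hτ⟩
  refine hG ⟨τ, fun E hE => ?_⟩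
  by_cases hEF : E ∈ F
  · exact hCF τ (satCNF_singleton.2 (hτ C (Finset.mem_insert_self _ _))) E hEF
  · exact hτ E (Finset.mem_insert_of_mem (Finset.mem_sdiff.2 ⟨hE, hEF⟩))

/-- in a saturated minimally unsatisfiable formula every pseudo-factor is
a factor; consequently, such a formula is strongly irreducible iff it is irreducible. -/
theorem smu_pseudo_factor_is_factor (G : CNF) (hwf : G.WellFormed)
    (hsmu : SaturatedMU G) :
    (∀ F : CNF, IsPseudoFactor F G → IsFactor F G) ∧
      (StronglyIrreducible G ↔ G.Irreducible) := by
  exact ⟨fun F => hsmu.isFactor_of_isPseudoFactor,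
    fun h F hF => h F (hF.isPseudoFactor hsmu.1),
    fun h F hF => h F (hsmu.isFactor_of_isPseudoFactor hF)⟩
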